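/- In any execution of the multi-writer auditable register implementation (Algorithm 1), every READ operation terminates within at most three iterations of its repeat loop, and consequently the step complexity of a READ operation is O(m+n). -/

import Mathlib

/-!
# An operational model of Algorithm 1 (multi-writer auditable register)

The algorithm implements an `n`-writer `m`-reader auditable register from an
unbounded array `SLR[-1,0,1,...]` of `(m+n)`-sliding registers, a max register
`M` storing a triple `(widx, ridx, auditset)` (ordered by its first field,
modelled here as an atomic object), and an array `H[1..m]` of single-writer
registers.  Each line of the pseudo-code is a step; readers, writers and
auditors are modelled by explicit program counters, and executions are
alternating sequences of configurations and labelled steps starting from the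
initial configuration.
-/

namespace Alg1

/-- Values stored in the auditable register. -/
abbrev Val := ℕ

/-- Entries of the sliding registers: `w`-tuples `(w, j, v, h)` posted by
    writers (with `h` a helping set of readers) and reader identifiers. -/
inductive Entry (m n : ℕ) where
  | w (j : Fin n) (v : Val) (h : Finset (Fin m))
  | r (i : Fin m)

variable {m n : ℕ}

def Entry.isW : Entry m n → Bool
  | .w _ _ _ => true
  | .r _ => false

/-- Does the window contain a `w`-tuple? -/
def hasW (win : List (Entry m n)) : Bool := win.any Entry.isW

/-- The first `w`-tuple in a window, if any. -/
def firstW : List (Entry m n) → Option (Fin n × Val × Finset (Fin m))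
  | [] => none
  | .w j v h :: _ => some (j, v, h)
  | .r _ :: rest => firstW rest

/-- `getValue`: the value of the first `w`-tuple of a window (default `0`). -/
def wval (win : List (Entry m n)) : Val := ((firstW win).map fun t => t.2.1).getD 0

/-- Reader identifiers that precede every `w`-tuple of a window. -/
def preW : List (Entry m n) → Finset (Fin m)
  | [] => ∅
  | .w _ _ _ :: _ => ∅
  | .r i :: rest => insert i (preW rest)

/-- `READERS(win)`: readers preceding every `w`-tuple, together with the
    helping set of the first `w`-tuple, if any. -/
def readersOf (win : List (Entry m n)) : Finset (Fin m) :=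
  preW win ∪ ((firstW win).map fun t => t.2.2).getD ∅

/-- Content of the max register `M`: a triple `(widx, ridx, auditset)`,
    ordered by the first field. -/
structure MVal (m : ℕ) where
  widx : ℤ
  ridx : Fin m → ℤ
  aud : Finset (Fin m × Val)

/-- Semantics of `writeMax` on `M`. -/
def wmax (old new : MVal m) : MVal m := if old.widx < new.widx then new else old

/-- The triple written to `M` after reading window `win` from `SLR[x]`:
    `(x+1, ridx[j ∈ READERS(win)] := x, auditset ∪ {(j, lv) : j ∈ READERS(win)})`. -/
def mArg (mc : MVal m) (win : List (Entry m n)) (x : ℤ) (lv : Val) : MVal m where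
  widx := x + 1
  ridx := fun j => if j ∈ readersOf win then x else mc.ridx j
  aud := mc.aud ∪ (readersOf win).image fun j => (j, lv)

/-- Write to a `k`-sliding register: append, keeping the last `k` entries. -/
def slide (k : ℕ) (l : List (Entry m n)) (e : Entry m n) : List (Entry m n) :=
  let l' := l ++ [e]
  l'.drop (l'.length - k)

/-- Program counter of a reader (one state per line of the pseudo-code). -/
inductive RPC where
  | idle
  | precheck   -- read `SLR[lsr]` (line `rd_last_wd`)
  | preM       -- read `M` (line `new_write`)
  | preHelp    -- `writeMax` on `M` (line `rd_help_M1`)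
  | loopM      -- read `M` at the head of the repeat loop (line `rd_M`)
  | helpVal    -- found help: read `SLR[lsr-1]` (`getValue`, line `rd_return_help`)
  | annH       -- write `H[i] := lsr` (line `rd_annouce_att`)
  | wSLR       -- write `i` to `SLR[lsr]` (line `rd_do_att`)
  | rSLR       -- read `SLR[lsr]` (line `rd_do_att`)
  | gVal       -- read `SLR[lsr-1]` (`getValue`, line `rd_val`)
  | helpChk    -- help the pending write to complete (line `rd_help_M2`)
  | loopEnd    -- evaluate the until condition (line `rd_att_success`)
  | retNow     -- return `lval`

structure RState (m n : ℕ) where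
  lsr : ℤ
  lval : Val
  mc : MVal m
  win : List (Entry m n)
  it : ℕ          -- number of iterations of the repeat loop of the current READ
  pc : RPC

/-- Program counter of a writer. -/
inductive WPC where
  | idle
  | readM    -- read `M` (line `w_read_M`)
  | scanH    -- read `H[k]` (line `w_att`)
  | scanS    -- read `SLR[a_k]` (line `w_help_wd`)
  | post     -- write the `w`-tuple to `SLR[widx]` (line `w_write_SLR`)
  | postR    -- read `SLR[widx]`
  | postV    -- read `SLR[widx-1]` (`getValue`)
  | postM    -- `writeMax` on `M` (line `w_write_M`)
  | wret     -- return

structure WState (m n : ℕ) where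
  v : Val
  mc : MVal m
  toHelp : Finset (Fin m)
  k : ℕ
  a : ℤ
  win : List (Entry m n)
  val : Val
  pc : WPC

/-- Program counter of an auditor. -/
inductive APC where
  | idle
  | aM       -- read `M` (line `adt_read_M`)
  | aR       -- read `SLR[widx]` (line `adt_val`)
  | aV       -- read `SLR[widx-1]` (`getValue`, line `adt_val`)
  | aret     -- return the audit set

structure AState (m n : ℕ) where
  mc : MVal m
  win : List (Entry m n)
  val : Val
  pc : APC

/-- Processes: `m` readers, `n` writers, and arbitrarily many auditors. -/
inductive Proc (m n : ℕ) where
  | rdr (i : Fin m)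
  | wtr (j : Fin n)
  | adt (a : ℕ)
  deriving DecidableEq

/-- A configuration: shared memory plus the local state of every process. -/
structure Config (m n : ℕ) where
  slr : ℤ → List (Entry m n)
  M : MVal m
  H : Fin m → ℤ
  rst : Fin m → RState m n
  wst : Fin n → WState m n
  ast : ℕ → AState m n

/-- Step labels: invocations and responses of high-level operations, and
    primitive operations applied to the base objects. -/
inductive Lbl (m n : ℕ) where
  | invRead (i : Fin m)
  | respRead (i : Fin m) (v : Val)
  | invWrite (j : Fin n) (v : Val)
  | respWrite (j : Fin n)
  | invAudit (a : ℕ)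
  | respAudit (a : ℕ) (A : Finset (Fin m × Val))
  | slrRead (p : Proc m n) (x : ℤ) (win : List (Entry m n))
  | slrWrite (p : Proc m n) (x : ℤ) (e : Entry m n)
  | mRead (p : Proc m n) (v : MVal m)
  | mWrite (p : Proc m n) (v : MVal m)
  | hRead (j : Fin n) (k : Fin m) (a : ℤ)
  | hWrite (i : Fin m) (x : ℤ)
  | tau (p : Proc m n)

def upR (c : Config m n) (i : Fin m) (s : RState m n) : Config m n :=
  { c with rst := Function.update c.rst i s }

def upW (c : Config m n) (j : Fin n) (s : WState m n) : Config m n :=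
  { c with wst := Function.update c.wst j s }

def upA (c : Config m n) (a : ℕ) (s : AState m n) : Config m n :=
  { c with ast := Function.update c.ast a s }

/-- The transition relation of Algorithm 1. -/
def Step (c : Config m n) (l : Lbl m n) (c' : Config m n) : Prop :=
  match l with
  | .invRead i =>
      let s := c.rst i
      s.pc = .idle ∧
      c' = upR c i { s with it := 0, pc := if 0 ≤ s.lsr then RPC.precheck else RPC.loopM }
  | .respRead i v =>
      let s := c.rst i
      s.pc = .retNow ∧ v = s.lval ∧ c' = upR c i { s with pc := .idle }
  | .invWrite j v =>
      let s := c.wst j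
      s.pc = .idle ∧ c' = upW c j { s with v := v, pc := .readM }
  | .respWrite j =>
      let s := c.wst j
      s.pc = .wret ∧ c' = upW c j { s with pc := .idle }
  | .invAudit a =>
      let s := c.ast a
      s.pc = .idle ∧ c' = upA c a { s with pc := .aM }
  | .respAudit a A =>
      let s := c.ast a
      s.pc = .aret ∧
      A = s.mc.aud ∪ (readersOf s.win).image (fun j => (j, s.val)) ∧
      c' = upA c a { s with pc := .idle }
  | .slrRead p x win =>
      win = c.slr x ∧
      (match p with
       | .rdr i =>
          let s := c.rst i
          (s.pc = .precheck ∧ x = s.lsr ∧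
             c' = upR c i { s with win := win, pc := if hasW win then RPC.preM else RPC.retNow }) ∨
          (s.pc = .helpVal ∧ x = s.lsr - 1 ∧
             c' = upR c i { s with lval := wval win, pc := .retNow }) ∨
          (s.pc = .rSLR ∧ x = s.lsr ∧
             c' = upR c i { s with win := win, pc := .gVal }) ∨
          (s.pc = .gVal ∧ x = s.lsr - 1 ∧
             c' = upR c i { s with lval := wval win, pc := .helpChk })
       | .wtr j =>
          let s := c.wst j
          (s.pc = .scanS ∧ x = s.a ∧
             (∃ hk : s.k < m,
               c' = upW c j { s with toHelp := if (⟨s.k, hk⟩ : Fin m) ∈ readersOf win then s.toHelp else insert (⟨s.k, hk⟩ : Fin m) s.toHelp, k := s.k + 1, pc := .scanH })) ∨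
          (s.pc = .postR ∧ x = s.mc.widx ∧
             c' = upW c j { s with win := win, pc := .postV }) ∨
          (s.pc = .postV ∧ x = s.mc.widx - 1 ∧
             c' = upW c j { s with val := wval win, pc := .postM })
       | .adt a =>
          let s := c.ast a
          (s.pc = .aR ∧ x = s.mc.widx ∧
             c' = upA c a { s with win := win, pc := .aV }) ∨
          (s.pc = .aV ∧ x = s.mc.widx - 1 ∧
             c' = upA c a { s with val := wval win, pc := .aret }))
  | .slrWrite p x e =>
      (match p with
       | .rdr i =>
          let s := c.rst i
          s.pc = .wSLR ∧ x = s.lsr ∧ e = .r i ∧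
          c' = { upR c i { s with pc := .rSLR } with
                 slr := Function.update c.slr x (slide (m + n) (c.slr x) e) }
       | .wtr j =>
          let s := c.wst j
          s.pc = .post ∧ x = s.mc.widx ∧ e = .w j s.v s.toHelp ∧
          c' = { upW c j { s with pc := .postR } with
                 slr := Function.update c.slr x (slide (m + n) (c.slr x) e) }
       | .adt _ => False)
  | .mRead p v =>
      v = c.M ∧
      (match p with
       | .rdr i =>
          let s := c.rst i
          (s.pc = .preM ∧
             c' = upR c i { s with mc := v, pc := if v.widx = s.lsr then RPC.preHelp else RPC.loopM }) ∨
          (s.pc = .loopM ∧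
             c' = upR c i (if s.lsr < v.ridx i then
                { s with mc := v, it := s.it + 1, lsr := v.ridx i, pc := .helpVal }
              else
                { s with mc := v, it := s.it + 1, lsr := v.widx, pc := .annH }))
       | .wtr j =>
          let s := c.wst j
          s.pc = .readM ∧
          c' = upW c j { s with mc := v, toHelp := ∅, k := 0, pc := .scanH }
       | .adt a =>
          let s := c.ast a
          s.pc = .aM ∧ c' = upA c a { s with mc := v, pc := .aR })
  | .mWrite p v =>
      (match p with
       | .rdr i =>
          let s := c.rst i
          (s.pc = .preHelp ∧ v = mArg s.mc s.win s.lsr s.lval ∧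
             c' = { upR c i { s with pc := .loopM } with M := wmax c.M v }) ∨
          (s.pc = .helpChk ∧ hasW s.win = true ∧ v = mArg s.mc s.win s.lsr s.lval ∧
             c' = { upR c i { s with pc := .loopEnd } with M := wmax c.M v })
       | .wtr j =>
          let s := c.wst j
          s.pc = .postM ∧ v = mArg s.mc s.win s.mc.widx s.val ∧
          c' = { upW c j { s with pc := .wret } with M := wmax c.M v }
       | .adt _ => False)
  | .hRead j k a =>
      let s := c.wst j
      s.pc = .scanH ∧ (k : ℕ) = s.k ∧ a = c.H k ∧
      c' = upW c j (if s.mc.ridx k < a then { s with a := a, pc := .scanS }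
                    else { s with k := s.k + 1 })
  | .hWrite i x =>
      let s := c.rst i
      s.pc = .annH ∧ x = s.lsr ∧
      c' = { upR c i { s with pc := .wSLR } with H := Function.update c.H i x }
  | .tau p =>
      match p with
      | .rdr i =>
          let s := c.rst i
          (s.pc = .helpChk ∧ hasW s.win = false ∧
             c' = upR c i { s with pc := .loopEnd }) ∨
          (s.pc = .loopEnd ∧
             c' = upR c i { s with pc := if i ∈ readersOf s.win then RPC.retNow else RPC.loopM })
      | .wtr j =>
          let s := c.wst j
          s.pc = .scanH ∧ s.k = m ∧ c' = upW c j { s with pc := .post }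
      | .adt _ => False

/-- The initial configuration: `SLR[-1]` holds `(w, j₀, v₀, ∅)`, all other
    sliding registers are empty, `M = (0, [-1,…,-1], ∅)`, `H = [-1,…,-1]`,
    and every process is idle (readers start with `lsr = -1`). -/
def init (m n : ℕ) (v0 : Val) (j0 : Fin n) : Config m n where
  slr := fun x => if x = -1 then [.w j0 v0 ∅] else []
  M := ⟨0, fun _ => -1, ∅⟩
  H := fun _ => -1
  rst := fun _ => ⟨-1, v0, ⟨0, fun _ => -1, ∅⟩, [], 0, .idle⟩
  wst := fun _ => ⟨v0, ⟨0, fun _ => -1, ∅⟩, ∅, 0, -1, [], v0, .idle⟩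
  ast := fun _ => ⟨⟨0, fun _ => -1, ∅⟩, [], v0, .idle⟩

/-- A finite execution of Algorithm 1: configurations `cfg 0, …, cfg len`
    connected by labelled steps. -/
structure Exec (m n : ℕ) (v0 : Val) (j0 : Fin n) where
  len : ℕ
  cfg : ℕ → Config m n
  lbl : ℕ → Lbl m n
  h0 : cfg 0 = init m n v0 j0
  hstep : ∀ t, t < len → Step (cfg t) (lbl t) (cfg (t + 1))

variable {v0 : Val} {j0 : Fin n}

/-! ### Derived notions -/

/-- The process performing a step. -/
def procOf : Lbl m n → Proc m n
  | .invRead i => .rdr i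
  | .respRead i _ => .rdr i
  | .invWrite j _ => .wtr j
  | .respWrite j => .wtr j
  | .invAudit a => .adt a
  | .respAudit a _ => .adt a
  | .slrRead p _ _ => p
  | .slrWrite p _ _ => p
  | .mRead p _ => p
  | .mWrite p _ => p
  | .hRead j _ _ => .wtr j
  | .hWrite i _ => .rdr i
  | .tau p => p

/-- The label writes a `w`-tuple to `SLR[x]`. -/
def isWWrite (l : Lbl m n) (x : ℤ) : Prop :=
  ∃ p j v h, l = .slrWrite p x (.w j v h)

/-- Step `t` is the first write of a `w`-tuple to `SLR[x]` in the execution. -/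
def FirstWWriteAt (E : Exec m n v0 j0) (x : ℤ) (t : ℕ) : Prop :=
  t < E.len ∧ isWWrite (E.lbl t) x ∧ ∀ t', t' < t → ¬ isWWrite (E.lbl t') x

/-- Step `t` changes `M.widx` from `ℓ - 1` to `ℓ`. -/
def WidxChangeAt (E : Exec m n v0 j0) (ℓ : ℤ) (t : ℕ) : Prop :=
  t < E.len ∧ (∃ p v, E.lbl t = .mWrite p v) ∧
  (E.cfg t).M.widx = ℓ - 1 ∧ (E.cfg (t + 1)).M.widx = ℓ

/-- `x` is the largest index of a sliding register containing a `w`-tuple. -/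
def WIDXis (c : Config m n) (x : ℤ) : Prop :=
  hasW (c.slr x) = true ∧ ∀ y : ℤ, x < y → hasW (c.slr y) = false

/-- Configuration in region `D_ℓ`: `M.widx = ℓ = WIDX + 1`. -/
def inD (c : Config m n) (ℓ : ℤ) : Prop := c.M.widx = ℓ ∧ WIDXis c (ℓ - 1)

/-- Configuration in region `E_ℓ`: `M.widx = ℓ = WIDX`. -/
def inE (c : Config m n) (ℓ : ℤ) : Prop := c.M.widx = ℓ ∧ WIDXis c ℓ

/-! ### Classification of operations, and linearizations -/

/-- Classification of the operations of Algorithm 1. -/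
inductive Kind where
  | silentR | directR | helpedR | visibleW | hiddenW | defA | nondefA
  deriving DecidableEq

/-- Rank used by the linearization rules `R1`–`R4` within a block of
    operations with the same index. -/
def rank : Kind → ℕ
  | .silentR => 0
  | .directR => 0
  | .nondefA => 0
  | .helpedR => 1
  | .defA => 2
  | .hiddenW => 3
  | .visibleW => 4

def Kind.isRead : Kind → Prop
  | .silentR => True | .directR => True | .helpedR => True
  | _ => False

def Kind.isWrite : Kind → Prop
  | .visibleW => True | .hiddenW => True
  | _ => False

def Kind.isAudit : Kind → Prop
  | .defA => True | .nondefA => True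
  | _ => False

/-- The data of a classified operation: its process, invocation step, optional
    response step, kind, associated sliding-register index `idx`, its
    characteristic step `key` on `SLR[idx]` (used by the linearization rules),
    its value (return value of a READ / input of a WRITE) and, for an AUDIT,
    the returned audit set. -/
structure OpData (m n : ℕ) where
  proc : Proc m n
  inv : ℕ
  resp : Option ℕ
  kind : Kind
  idx : ℤ
  key : ℕ
  val : Val
  aset : Finset (Fin m × Val)

/-- The label is a response event of process `p`. -/
def isRespOf (l : Lbl m n) (p : Proc m n) : Prop :=
  (∃ i v, p = .rdr i ∧ l = .respRead i v) ∨
  (∃ j, p = .wtr j ∧ l = .respWrite j) ∨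
  (∃ a A, p = .adt a ∧ l = .respAudit a A)

/-- `resp` is the matching response of the operation of `p` invoked at `a`
    (or the operation is pending if `resp = none`). -/
def RespMatch (E : Exec m n v0 j0) (p : Proc m n) (a : ℕ) : Option ℕ → Prop
  | some b => a < b ∧ b < E.len ∧ isRespOf (E.lbl b) p ∧
      ∀ t, a < t → t < b → ¬ isRespOf (E.lbl t) p
  | none => ∀ t, a < t → t < E.len → ¬ isRespOf (E.lbl t) p

/-- `x` is the smallest index `> x0` of a sliding register in which reader `i`
    is recorded (evaluated in the final configuration). -/
def minRecIdx (E : Exec m n v0 j0) (i : Fin m) (x0 x : ℤ) : Prop :=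
  x0 < x ∧ i ∈ readersOf ((E.cfg E.len).slr x) ∧
    ∀ y : ℤ, x0 < y → y < x → i ∉ readersOf ((E.cfg E.len).slr y)

/-- The return value of a classified READ: the actual response if the READ is
    complete; for a pending classified READ (completed in `H'`), the value of
    the first `w`-tuple of `SLR[idx-1]`. -/
def ReadValOK (E : Exec m n v0 j0) (o : OpData m n) (i : Fin m) : Prop :=
  match o.resp with
  | some b => E.lbl b = .respRead i o.val
  | none => o.val = wval ((E.cfg E.len).slr (o.idx - 1))

/-- `o` describes a classified operation of the execution `E`. -/
def IsOp (E : Exec m n v0 j0) (o : OpData m n) : Prop :=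
  o.inv < E.len ∧ RespMatch E o.proc o.inv o.resp ∧
  match o.kind with
  | .silentR =>
      ∃ i b win, o.proc = .rdr i ∧ o.resp = some b ∧
        E.lbl o.inv = .invRead i ∧
        (∃ t', t' < o.inv ∧ E.lbl t' = .invRead i) ∧
        o.idx = ((E.cfg o.inv).rst i).lsr ∧
        o.inv < o.key ∧ o.key < b ∧
        E.lbl o.key = .slrRead (.rdr i) o.idx win ∧
        ((E.cfg o.key).rst i).pc = .precheck ∧
        hasW win = false ∧
        E.lbl b = .respRead i o.val ∧
        o.aset = ∅
  | .directR =>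
      ∃ i, o.proc = .rdr i ∧ E.lbl o.inv = .invRead i ∧
        minRecIdx E i ((E.cfg o.inv).rst i).lsr o.idx ∧
        i ∈ preW ((E.cfg E.len).slr o.idx) ∧
        o.inv < o.key ∧ o.key < E.len ∧
        E.lbl o.key = .slrWrite (.rdr i) o.idx (.r i) ∧
        (∀ b, o.resp = some b → o.key < b) ∧
        ReadValOK E o i ∧ o.aset = ∅
  | .helpedR =>
      ∃ i, o.proc = .rdr i ∧ E.lbl o.inv = .invRead i ∧
        minRecIdx E i ((E.cfg o.inv).rst i).lsr o.idx ∧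
        i ∉ preW ((E.cfg E.len).slr o.idx) ∧
        o.key = o.inv ∧ ReadValOK E o i ∧ o.aset = ∅
  | .visibleW =>
      ∃ j h, o.proc = .wtr j ∧ E.lbl o.inv = .invWrite j o.val ∧
        o.inv < o.key ∧ o.key < E.len ∧
        E.lbl o.key = .slrWrite (.wtr j) o.idx (.w j o.val h) ∧
        (∀ b, o.resp = some b → o.key < b) ∧
        firstW ((E.cfg E.len).slr o.idx) = some (j, o.val, h) ∧
        o.aset = ∅
  | .hiddenW =>
      ∃ j h, o.proc = .wtr j ∧ E.lbl o.inv = .invWrite j o.val ∧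
        o.inv < o.key ∧ o.key < E.len ∧
        E.lbl o.key = .slrWrite (.wtr j) o.idx (.w j o.val h) ∧
        (∀ b, o.resp = some b → o.key < b) ∧
        firstW ((E.cfg E.len).slr o.idx) ≠ some (j, o.val, h) ∧
        o.aset = ∅
  | .defA =>
      ∃ a b tM mv win, o.proc = .adt a ∧ o.resp = some b ∧
        E.lbl o.inv = .invAudit a ∧
        o.inv < tM ∧ tM < o.key ∧ o.key < b ∧
        E.lbl tM = .mRead (.adt a) mv ∧ ((E.cfg tM).ast a).pc = .aM ∧
        o.idx = mv.widx ∧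
        E.lbl o.key = .slrRead (.adt a) o.idx win ∧
        ((E.cfg o.key).ast a).pc = .aR ∧
        hasW win = true ∧
        E.lbl b = .respAudit a o.aset ∧ o.val = 0
  | .nondefA =>
      ∃ a b tM mv win, o.proc = .adt a ∧ o.resp = some b ∧
        E.lbl o.inv = .invAudit a ∧
        o.inv < tM ∧ tM < o.key ∧ o.key < b ∧
        E.lbl tM = .mRead (.adt a) mv ∧ ((E.cfg tM).ast a).pc = .aM ∧
        o.idx = mv.widx ∧
        E.lbl o.key = .slrRead (.adt a) o.idx win ∧
        ((E.cfg o.key).ast a).pc = .aR ∧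
        hasW win = false ∧
        E.lbl b = .respAudit a o.aset ∧ o.val = 0

/-- `o` terminates (its response event occurs) before `o'` starts. -/
def EndsBefore (o o' : OpData m n) : Prop :=
  ∃ b, o.resp = some b ∧ b < o'.inv

/-- `lt` is a linearization of the classified operations of `E` obeying the
    rules `R0`–`R4`: a strict total order on classified operations, ordering
    operations by increasing `idx` (`R0`); within the same `idx`, first
    silent READs, direct READs and non-definitive AUDITs ordered by their
    characteristic step on `SLR[idx]` (`R1`), then helped READs in arbitrary
    order followed by the definitive AUDITs ordered by their read of
    `SLR[idx]` (`R2`), then the hidden WRITEs ordered by their write to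
    `SLR[idx]` (`R3`), and the visible WRITE last (`R4`). -/
def LinOK (E : Exec m n v0 j0) (lt : OpData m n → OpData m n → Prop) : Prop :=
  (∀ o, IsOp E o → ¬ lt o o) ∧
  (∀ o₁ o₂ o₃, IsOp E o₁ → IsOp E o₂ → IsOp E o₃ →
      lt o₁ o₂ → lt o₂ o₃ → lt o₁ o₃) ∧
  (∀ o₁ o₂, IsOp E o₁ → IsOp E o₂ → o₁ ≠ o₂ → lt o₁ o₂ ∨ lt o₂ o₁) ∧
  (∀ o₁ o₂, IsOp E o₁ → IsOp E o₂ → o₁.idx < o₂.idx → lt o₁ o₂) ∧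
  (∀ o₁ o₂, IsOp E o₁ → IsOp E o₂ → o₁.idx = o₂.idx →
      rank o₁.kind < rank o₂.kind → lt o₁ o₂) ∧
  (∀ o₁ o₂, IsOp E o₁ → IsOp E o₂ → o₁.idx = o₂.idx →
      rank o₁.kind = rank o₂.kind → o₁.kind ≠ .helpedR →
      o₁.key < o₂.key → lt o₁ o₂)

/-! ### List lemmas -/

theorem hasW_append (l t : List (Entry m n)) : hasW (l ++ t) = (hasW l || hasW t) := by
  simp [hasW]

theorem hasW_pre {l l' : List (Entry m n)} (h : l <+: l') (hw : hasW l = true) :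
    hasW l' = true := by
  obtain ⟨t, rfl⟩ := h
  simp [hasW_append, hw]

theorem firstW_append {l : List (Entry m n)} (t : List (Entry m n)) (h : hasW l = true) :
    firstW (l ++ t) = firstW l := by
  induction l with
  | nil => simp [hasW] at h
  | cons e l ih =>
    cases e with
    | w => rfl
    | r i => simpa [firstW, hasW, Entry.isW] using ih (by simpa [hasW, Entry.isW] using h)

theorem preW_append {l : List (Entry m n)} (t : List (Entry m n)) (h : hasW l = true) :
    preW (l ++ t) = preW l := by
  induction l with
  | nil => simp [hasW] at h
  | cons e l ih =>
    cases e with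
    | w => rfl
    | r i => simp [preW, ih (by simpa [hasW, Entry.isW] using h)]

theorem preW_sub (l t : List (Entry m n)) : preW l ⊆ preW (l ++ t) := by
  induction l with
  | nil => simp [preW]
  | cons e l ih =>
    cases e with
    | w => simp [preW]
    | r i => simpa [preW] using Finset.insert_subset_insert i ih

theorem firstW_none {l : List (Entry m n)} (h : hasW l = false) : firstW l = none := by
  induction l with
  | nil => rfl
  | cons e l ih =>
    cases e with
    | w => simp [hasW, Entry.isW] at h
    | r i => simpa [firstW] using ih (by simpa [hasW, Entry.isW] using h)

theorem readersOf_eq {l l' : List (Entry m n)} (h : l <+: l') (hw : hasW l = true) :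
    readersOf l' = readersOf l := by
  obtain ⟨t, rfl⟩ := h
  simp [readersOf, firstW_append t hw, preW_append t hw]

theorem readersOf_mono {l l' : List (Entry m n)} (h : l <+: l') :
    readersOf l ⊆ readersOf l' := by
  by_cases hw : hasW l = true
  · rw [readersOf_eq h hw]
  · obtain ⟨t, rfl⟩ := h
    have : readersOf l = preW l := by
      simp [readersOf, firstW_none (by simpa using hw : hasW l = false)]
    rw [this]
    exact (preW_sub l t).trans Finset.subset_union_left

theorem mem_readersOf {l : List (Entry m n)} {i : Fin m} (h : Entry.r i ∈ l)
    (hw : hasW l = false) : i ∈ readersOf l := by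
  apply Finset.mem_union_left
  induction l with
  | nil => simp at h
  | cons e l ih =>
    cases e with
    | w => simp [hasW, Entry.isW] at hw
    | r i' =>
      have hw' : hasW l = false := by simpa [hasW, Entry.isW] using hw
      rcases List.mem_cons.1 h with h | h
      · cases h; simp [preW]
      · simp [preW, ih h hw']

theorem readersOf_w {l : List (Entry m n)} (hw : hasW l = false) (j : Fin n) (v : Val)
    (h : Finset (Fin m)) : h ⊆ readersOf (l ++ [.w j v h]) := by
  have : firstW (l ++ [.w j v h]) = some (j, v, h) := by
    induction l with
    | nil => rfl
    | cons e l ih =>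
      cases e with
      | w => simp [hasW, Entry.isW] at hw
      | r i => simpa [firstW] using ih (by simpa [hasW, Entry.isW] using hw)
  simp [readersOf, this]

/-- The process that wrote an entry. -/
def own : Entry m n → Fin m ⊕ Fin n
  | .w j _ _ => .inr j
  | .r i => .inl i

theorem slide_eq {l : List (Entry m n)} {e : Entry m n}
    (h : ((l ++ [e]).map own).Nodup) : slide (m + n) l e = l ++ [e] := by
  have h1 := h.length_le_card
  have h2 : (l ++ [e]).length - (m + n) = 0 := by
    simp at h1 ⊢
    omega
  unfold slide
  simp only [h2, List.drop_zero]

/-! ### The invariant -/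

/-- A triple that is, or was, stored in `M`. -/
structure Good (S : ℤ → List (Entry m n)) (W : ℤ) (mv : MVal m) : Prop where
  pos : 0 ≤ mv.widx
  le : mv.widx ≤ W
  lo : ∀ i, -1 ≤ mv.ridx i
  hi : ∀ i, mv.ridx i < mv.widx
  non : ∀ i x, mv.ridx i < x → x < mv.widx → i ∉ readersOf (S x)
  mem : ∀ i, 0 ≤ mv.ridx i → i ∈ readersOf (S (mv.ridx i))

/-- Invariant of the shared memory. -/
structure SInv (S : ℤ → List (Entry m n)) (M : MVal m) : Prop where
  wlow : ∀ x, -1 ≤ x → x < M.widx → hasW (S x) = true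
  empt : ∀ x, M.widx < x → S x = []
  good : Good S M.widx M
  nodup : ∀ x, ((S x).map own).Nodup

/-- Part of the reader invariant that depends on the program counter. -/
def RPcInv (S : ℤ → List (Entry m n)) (W : ℤ) (h : ℤ) (s : RState m n) (i : Fin m) : Prop :=
  match s.pc with
  | .idle => True
  | .retNow => True
  | .precheck => 0 ≤ s.lsr ∧ s.it = 0
  | .preM => 0 ≤ s.lsr ∧ s.it = 0 ∧ hasW s.win = true ∧ s.win <+: S s.lsr
  | .preHelp => 0 ≤ s.lsr ∧ s.it = 0 ∧ hasW s.win = true ∧ s.win <+: S s.lsr ∧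
      Good S W s.mc ∧ s.mc.widx = s.lsr
  | .loopM => s.lsr < W ∧ s.it ≤ 2 ∧
      (1 ≤ s.it → 0 ≤ s.lsr ∧ h = s.lsr ∧ i ∉ readersOf (S s.lsr))
  | .helpVal => s.lsr < W
  | .annH => 0 ≤ s.lsr ∧ 1 ≤ s.it ∧ Good S W s.mc ∧ s.mc.widx = s.lsr ∧ Entry.r i ∉ S s.lsr
  | .wSLR => 0 ≤ s.lsr ∧ 1 ≤ s.it ∧ Good S W s.mc ∧ s.mc.widx = s.lsr ∧ Entry.r i ∉ S s.lsr ∧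
      h = s.lsr
  | .rSLR => 0 ≤ s.lsr ∧ 1 ≤ s.it ∧ Good S W s.mc ∧ s.mc.widx = s.lsr ∧ h = s.lsr ∧
      Entry.r i ∈ S s.lsr
  | .gVal => 0 ≤ s.lsr ∧ 1 ≤ s.it ∧ Good S W s.mc ∧ s.mc.widx = s.lsr ∧ h = s.lsr ∧
      Entry.r i ∈ s.win ∧ s.win <+: S s.lsr
  | .helpChk => 0 ≤ s.lsr ∧ 1 ≤ s.it ∧ Good S W s.mc ∧ s.mc.widx = s.lsr ∧ h = s.lsr ∧
      Entry.r i ∈ s.win ∧ s.win <+: S s.lsr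
  | .loopEnd => 0 ≤ s.lsr ∧ 1 ≤ s.it ∧ h = s.lsr ∧
      Entry.r i ∈ s.win ∧ s.win <+: S s.lsr ∧ (hasW s.win = true → s.lsr < W)

/-- Invariant of a reader. -/
structure RInv (S : ℤ → List (Entry m n)) (W : ℤ) (h : ℤ) (s : RState m n) (i : Fin m) :
    Prop where
  lo : -1 ≤ s.lsr
  hi : s.lsr ≤ W
  it3 : s.it ≤ 3
  bnd : ∀ x, Entry.r i ∈ S x → x ≤ s.lsr
  pci : RPcInv S W h s i

/-- Invariant of a writer. -/
def WInv (S : ℤ → List (Entry m n)) (W : ℤ) (s : WState m n) (j : Fin n) : Prop :=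
  match s.pc with
  | .idle => ∀ x v h, Entry.w j v h ∈ S x → x < W
  | .readM => ∀ x v h, Entry.w j v h ∈ S x → x < W
  | .wret => ∀ x v h, Entry.w j v h ∈ S x → x < W
  | .scanH => Good S W s.mc ∧ ∀ x v h, Entry.w j v h ∈ S x → x < s.mc.widx
  | .scanS => Good S W s.mc ∧ ∀ x v h, Entry.w j v h ∈ S x → x < s.mc.widx
  | .post => Good S W s.mc ∧ s.k = m ∧ ∀ x v h, Entry.w j v h ∈ S x → x < s.mc.widx
  | .postR => Good S W s.mc ∧ hasW (S s.mc.widx) = true ∧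
      ∀ x v h, Entry.w j v h ∈ S x → x ≤ s.mc.widx
  | .postV => Good S W s.mc ∧ hasW s.win = true ∧ s.win <+: S s.mc.widx ∧
      ∀ x v h, Entry.w j v h ∈ S x → x ≤ s.mc.widx
  | .postM => Good S W s.mc ∧ hasW s.win = true ∧ s.win <+: S s.mc.widx ∧
      ∀ x v h, Entry.w j v h ∈ S x → x ≤ s.mc.widx

/-- The program counter is inside the repeat loop (and no help was found). -/
def inLoop : RPC → Prop
  | .loopM | .annH | .wSLR | .rSLR | .gVal | .helpChk | .loopEnd => True
  | _ => False

/-- A scanning writer helps reader `i`, whose first attempt was at `l1`. -/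
def WC (S : ℤ → List (Entry m n)) (s : WState m n) (i : Fin m) (l1 : ℤ) : Prop :=
  (s.pc = .scanH ∨ s.pc = .scanS ∨ s.pc = .post) →
    ((i : ℕ) < s.k → i ∈ s.toHelp ∨ i ∈ readersOf (S s.mc.widx)) ∧
    (s.pc = .scanS → s.k = i → l1 ≤ s.a ∧ s.a ≤ s.mc.widx)

/-- Helping invariant, from the second iteration of a READ on. -/
def Ph (S : ℤ → List (Entry m n)) (h : ℤ) (s : RState m n) (i : Fin m)
    (ws : Fin n → WState m n) : Prop :=
  inLoop s.pc → 2 ≤ s.it → ∃ l1, 0 ≤ l1 ∧ l1 ≤ h ∧ h ≤ s.lsr ∧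
    (∀ x, l1 ≤ x → x < s.lsr → i ∉ readersOf (S x)) ∧
    ∀ w, s.lsr ≤ w → (s.it = 2 → s.lsr < w) →
      (∀ x, l1 ≤ x → x < w → i ∉ readersOf (S x)) →
      (hasW (S w) = true → i ∈ readersOf (S w)) ∧
      ∀ j, (ws j).mc.widx = w → WC S (ws j) i l1

structure Inv (c : Config m n) : Prop where
  sh : SInv c.slr c.M
  rd : ∀ i, RInv c.slr c.M.widx (c.H i) (c.rst i) i
  wr : ∀ j, WInv c.slr c.M.widx (c.wst j) j
  ph : ∀ i, Ph c.slr (c.H i) (c.rst i) i c.wst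

theorem inv_init (v0 : Val) (j0 : Fin n) : Inv (init m n v0 j0) := by
  constructor
  · constructor
    · intro x h1 h2
      have : x = -1 := by simp [init] at h2; omega
      simp [init, this, hasW, Entry.isW]
    · intro x h
      have : x ≠ -1 := by simp [init] at h; omega
      simp [init, this]
    · constructor <;> simp [init]
      intro i x h1 h2; omega
    · intro x
      by_cases h : x = -1 <;> simp [init, h]
  · intro i
    constructor <;> simp [init, RPcInv]
  · intro j
    simp only [init, WInv]
    intro x v h
    by_cases h : x = -1 <;> simp [h]
  · intro i h
    simp [init, inLoop] at h

/-! ### Frame lemmas -/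

section frame
variable {S S' : ℤ → List (Entry m n)} {W W' : ℤ}

theorem Good.frame {mv : MVal m} (g : Good S W mv)
    (wl : ∀ x, -1 ≤ x → x < W → hasW (S x) = true) (pre : ∀ x, S x <+: S' x) (hW : W ≤ W') :
    Good S' W' mv := by
  refine ⟨g.pos, g.le.trans hW, g.lo, g.hi, ?_, ?_⟩
  · intro i x h1 h2
    rw [readersOf_eq (pre x) (wl x (by have := g.lo i; omega) (by have := g.le; omega))]
    exact g.non i x h1 h2
  · intro i h
    exact readersOf_mono (pre _) (g.mem i h)

theorem RInv.frame {h : ℤ} {s : RState m n} {i : Fin m} (r : RInv S W h s i)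
    (wl : ∀ x, -1 ≤ x → x < W → hasW (S x) = true) (pre : ∀ x, S x <+: S' x) (hW : W ≤ W')
    (hr : ∀ x, Entry.r i ∈ S' x → Entry.r i ∈ S x) : RInv S' W' h s i := by
  refine ⟨r.lo, r.hi.trans hW, r.it3, fun x hx => r.bnd x (hr x hx), ?_⟩
  have g : ∀ mv, Good S W mv → Good S' W' mv := fun mv g => g.frame wl pre hW
  have p : ∀ l x, l <+: S x → l <+: S' x := fun l x h => h.trans (pre x)
  have q : ∀ x, -1 ≤ x → x < W → readersOf (S' x) = readersOf (S x) :=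
    fun x h1 h2 => readersOf_eq (pre x) (wl x h1 h2)
  have u : ∀ e x, e ∈ S x → e ∈ S' x := fun e x h => (pre x).subset h
  have lo := r.lo
  have := r.pci
  clear r pre wl
  unfold RPcInv at *
  cases hp : s.pc <;> simp only [hp] at this ⊢ <;> grind

theorem WInv.frame {s : WState m n} {j : Fin n} (r : WInv S W s j)
    (wl : ∀ x, -1 ≤ x → x < W → hasW (S x) = true) (pre : ∀ x, S x <+: S' x) (hW : W ≤ W')
    (hr : ∀ x v h, Entry.w j v h ∈ S' x → Entry.w j v h ∈ S x) : WInv S' W' s j := by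
  have g : ∀ mv, Good S W mv → Good S' W' mv := fun mv g => g.frame wl pre hW
  have p : ∀ l x, l <+: S x → l <+: S' x := fun l x h => h.trans (pre x)
  have q : ∀ x, hasW (S x) = true → hasW (S' x) = true := fun x h1 => hasW_pre (pre x) h1
  clear pre wl
  unfold WInv at *
  cases hp : s.pc <;> simp only [hp] at r ⊢ <;> grind

theorem WC.frame {s : WState m n} {i : Fin m} {l1 : ℤ} (r : WC S s i l1)
    (pre : ∀ x, S x <+: S' x) : WC S' s i l1 := by
  intro h
  refine ⟨fun hk => ?_, (r h).2⟩
  rcases (r h).1 hk with h | h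
  · exact .inl h
  · exact .inr (readersOf_mono (pre _) h)

/-- `Ph` is preserved by all steps that neither write a `w`-tuple, nor change the state of a
writer, nor start a new iteration. -/
theorem Ph.frame {h h' : ℤ} {s s' : RState m n} {i : Fin m} {ws : Fin n → WState m n}
    (p : Ph S h s i ws)
    (wl : ∀ x, -1 ≤ x → x < W → hasW (S x) = true) (pre : ∀ x, S x <+: S' x)
    (hW : s.lsr ≤ W) (hpc : inLoop s'.pc → inLoop s.pc) (hl : inLoop s'.pc → s'.lsr = s.lsr)
    (hi : s'.it = s.it) (hh : h' = h ∨ h' = s.lsr)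
    (hw : ∀ x, hasW (S' x) = hasW (S x)) : Ph S' h' s' i ws := by
  intro h1 h2
  rw [hi] at h2 ⊢
  rw [hl h1]
  obtain ⟨l1, a1, a2, a3, a4, a5⟩ := p (hpc h1) h2
  refine ⟨l1, a1, by omega, by omega, ?_, ?_⟩
  · intro x b1 b2
    rw [readersOf_eq (pre x) (wl x (by omega) (by omega))]
    exact a4 x b1 b2
  · intro w b1 b2 b3
    obtain ⟨c1, c2⟩ := a5 w b1 b2 (fun x d1 d2 d3 => b3 x d1 d2 (readersOf_mono (pre x) d3))
    exact ⟨fun d => readersOf_mono (pre w) (c1 (by rwa [hw] at d)),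
      fun j hj => (c2 j hj).frame pre⟩

/-- `Ph` under a step that only changes the local state of writer `j`. -/
theorem Ph.upW {h : ℤ} {s : RState m n} {i : Fin m} {ws : Fin n → WState m n}
    (p : Ph S h s i ws) (j : Fin n) (s' : WState m n)
    (hs : ∀ l1, 0 ≤ l1 → l1 ≤ h → h ≤ s'.mc.widx →
      (∀ x, l1 ≤ x → x < s'.mc.widx → i ∉ readersOf (S x)) →
      ((ws j).mc.widx = s'.mc.widx → WC S (ws j) i l1) → WC S s' i l1) :
    Ph S h s i (Function.update ws j s') := by
  intro h1 h2
  obtain ⟨l1, a1, a2, a3, a4, a5⟩ := p h1 h2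
  refine ⟨l1, a1, a2, a3, a4, ?_⟩
  intro w b1 b2 b3
  obtain ⟨c1, c2⟩ := a5 w b1 b2 b3
  refine ⟨c1, fun j' hj => ?_⟩
  by_cases e : j' = j
  · subst e
    simp only [Function.update_self] at hj ⊢
    subst hj
    exact hs l1 a1 a2 (by omega) b3 (fun h => c2 _ h)
  · simp only [Function.update_of_ne e] at hj ⊢
    exact c2 _ hj

end frame

/-! ### Generic steps -/

/-- Local step of a reader. -/
theorem Inv.upR {c : Config m n} (I : Inv c) (i : Fin m) (s : RState m n)
    (hr : RInv c.slr c.M.widx (c.H i) s i) (hp : Ph c.slr (c.H i) s i c.wst) :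
    Inv (upR c i s) := by
  refine ⟨I.sh, ?_, I.wr, ?_⟩ <;> intro i' <;> by_cases e : i' = i
  · subst e; simpa [Alg1.upR] using hr
  · simpa [Alg1.upR, e] using I.rd i'
  · subst e; simpa [Alg1.upR] using hp
  · simpa [Alg1.upR, e] using I.ph i'

/-- Local step of a reader that does not start an iteration. -/
theorem Inv.upR' {c : Config m n} (I : Inv c) (i : Fin m) (s : RState m n)
    (hr : RInv c.slr c.M.widx (c.H i) s i)
    (hpc : inLoop s.pc → inLoop (c.rst i).pc ∨ s.it = 0)
    (hl : inLoop s.pc → s.lsr = (c.rst i).lsr)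
    (hi : inLoop s.pc → s.it = (c.rst i).it) : Inv (Alg1.upR c i s) := by
  refine I.upR i s hr ?_
  intro h1 h2
  have := (I.ph i).frame (s' := s) I.sh.wlow (fun _ => List.prefix_rfl) (I.rd i).hi
    (fun h => by have := hpc h; grind) hl (hi h1) (.inl rfl) (fun _ => rfl)
  exact this h1 h2

/-- Local step of a writer. -/
theorem Inv.upW {c : Config m n} (I : Inv c) (j : Fin n) (s : WState m n)
    (hr : WInv c.slr c.M.widx s j)
    (hs : ∀ i l1, 0 ≤ l1 → l1 ≤ c.H i → c.H i ≤ s.mc.widx →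
      (∀ x, l1 ≤ x → x < s.mc.widx → i ∉ readersOf (c.slr x)) →
      ((c.wst j).mc.widx = s.mc.widx → WC c.slr (c.wst j) i l1) → WC c.slr s i l1) :
    Inv (upW c j s) := by
  refine ⟨I.sh, I.rd, ?_, ?_⟩
  · intro j'
    by_cases e : j' = j
    · subst e; simpa [Alg1.upW] using hr
    · simpa [Alg1.upW, e] using I.wr j'
  · intro i
    exact (I.ph i).upW j s (hs i)

theorem Inv.upA {c : Config m n} (I : Inv c) (a : ℕ) (s : AState m n) : Inv (upA c a s) :=
  ⟨I.sh, I.rd, I.wr, I.ph⟩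

/-- `writeMax` on `M`. -/
theorem Inv.mw {c : Config m n} (I : Inv c) {mc : MVal m} {win : List (Entry m n)} {x : ℤ}
    (lv : Val) (g : Good c.slr c.M.widx mc) (hx : mc.widx = x) (hw : hasW win = true)
    (hp : win <+: c.slr x) :
    Inv { c with M := wmax c.M (mArg mc win x lv) } ∧
      c.M.widx ≤ (wmax c.M (mArg mc win x lv)).widx ∧
      x < (wmax c.M (mArg mc win x lv)).widx := by
  subst hx
  unfold wmax
  split_ifs with hlt
  swap
  · exact ⟨I, le_rfl, by simp [mArg] at hlt; omega⟩
  have hlt' : c.M.widx < mc.widx + 1 := hlt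
  have hge := g.le
  have hMx : c.M.widx = mc.widx := by omega
  have hle : c.M.widx ≤ (mArg mc win mc.widx lv).widx := hlt.le
  have hR := readersOf_eq hp hw
  refine ⟨⟨⟨?_, ?_, ?_, I.sh.nodup⟩, ?_, ?_, I.ph⟩, hle, by simp [mArg]⟩
  · intro y h1 h2
    have h2' : y < mc.widx + 1 := h2
    by_cases e : y = mc.widx
    · subst e; exact hasW_pre hp hw
    · exact I.sh.wlow y h1 (by omega)
  · intro y h
    have h2' : mc.widx + 1 < y := h
    exact I.sh.empt y (by omega)
  · refine ⟨by have := g.pos; simp [mArg]; omega, le_rfl, ?_, ?_, ?_, ?_⟩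
    · intro i
      have := g.lo i; have := g.pos
      simp only [mArg]; split_ifs <;> omega
    · intro i
      have := g.hi i
      simp only [mArg]; split_ifs <;> omega
    · intro i y
      simp only [mArg]
      split_ifs with hm
      · intro h1 h2; omega
      · intro h1 h2
        by_cases e : y = mc.widx
        · subst e; rwa [hR]
        · exact g.non i y h1 (by omega)
    · intro i
      simp only [mArg]
      split_ifs with hm
      · intro _; rwa [hR]
      · exact g.mem i
  · intro i
    exact (I.rd i).frame I.sh.wlow (fun _ => List.prefix_rfl) hle (fun _ h => h)
  · intro j
    exact (I.wr j).frame I.sh.wlow (fun _ => List.prefix_rfl) hle (fun _ _ _ h => h)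

/-- Announcement of an attempt. -/
theorem Inv.hw {c : Config m n} (I : Inv c) (i : Fin m) (h : (c.rst i).pc = .annH) :
    Inv { c with H := Function.update c.H i (c.rst i).lsr } := by
  refine ⟨I.sh, ?_, I.wr, ?_⟩ <;> intro i' <;> by_cases e : i' = i
  · subst e
    have := I.rd i'
    refine ⟨this.lo, this.hi, this.it3, this.bnd, ?_⟩
    have := this.pci
    simpa [RPcInv, h] using this
  · simpa [e] using I.rd i'
  · subst e
    exact (I.ph i').frame I.sh.wlow (fun _ => List.prefix_rfl) (I.rd i').hi id (fun _ => rfl) rfl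
      (by simp) (fun _ => rfl)
  · simpa [e] using I.ph i'

/-- Shared memory after a write to a sliding register. -/
theorem SInv.app {S : ℤ → List (Entry m n)} {M : MVal m} (I : SInv S M) {x : ℤ}
    {e : Entry m n} (hx : x ≤ M.widx) (ho : own e ∉ (S x).map own) :
    slide (m + n) (S x) e = S x ++ [e] ∧
    (∀ y, S y <+: Function.update S x (slide (m + n) (S x) e) y) ∧
    SInv (Function.update S x (slide (m + n) (S x) e)) M := by
  have nd : ((S x ++ [e]).map own).Nodup := by
    rw [List.map_append, List.nodup_append]
    refine ⟨I.nodup x, by simp, ?_⟩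
    intro a ha b hb
    simp only [List.map_cons, List.map_nil, List.mem_singleton] at hb
    subst hb
    rintro rfl
    exact ho ha
  have sl := slide_eq nd
  have pre : ∀ y, S y <+: Function.update S x (slide (m + n) (S x) e) y := by
    intro y
    by_cases h : y = x
    · subst h; simp [sl]
    · simp [h]
  refine ⟨sl, pre, ?_, ?_, ?_, ?_⟩
  · intro y h1 h2
    exact hasW_pre (pre y) (I.wlow y h1 h2)
  · intro y h
    have : y ≠ x := by omega
    simpa [this] using I.empt y h
  · exact I.good.frame I.wlow pre le_rfl
  · intro y
    by_cases h : y = x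
    · subst h; simpa [sl] using nd
    · simpa [h] using I.nodup y

/-- A reader writes its identifier. -/
theorem Inv.rw {c : Config m n} (I : Inv c) (i : Fin m) (h : (c.rst i).pc = .wSLR) :
    Inv { Alg1.upR c i { c.rst i with pc := .rSLR } with
      slr := Function.update c.slr (c.rst i).lsr
        (slide (m + n) (c.slr (c.rst i).lsr) (.r i)) } := by
  have R := I.rd i
  have P := R.pci
  simp only [RPcInv, h] at P
  obtain ⟨p1, p2, p3, p4, p5, p6⟩ := P
  have ho : own (.r i : Entry m n) ∉ (c.slr (c.rst i).lsr).map own := by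
    intro hm
    obtain ⟨e, he, heq⟩ := List.mem_map.1 hm
    cases e with
    | w => simp [own] at heq
    | r i' => simp [own] at heq; subst heq; exact p5 he
  obtain ⟨sl, pre, sh⟩ := I.sh.app R.hi ho
  have memS : ∀ y e, e ∈ Function.update c.slr (c.rst i).lsr
        (slide (m + n) (c.slr (c.rst i).lsr) (.r i)) y →
      e ∈ c.slr y ∨ (y = (c.rst i).lsr ∧ e = .r i) := by
    intro y e he
    by_cases h : y = (c.rst i).lsr
    · subst h; simpa [sl] using he
    · simp [h] at he; exact .inl he
  have hw : ∀ y, hasW (Function.update c.slr (c.rst i).lsr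
        (slide (m + n) (c.slr (c.rst i).lsr) (.r i)) y) = hasW (c.slr y) := by
    intro y
    by_cases h : y = (c.rst i).lsr
    · subst h; simp [sl, hasW, Entry.isW]
    · simp [h]
  refine ⟨sh, ?_, ?_, ?_⟩
  · intro i'
    by_cases e : i' = i
    · subst e
      simp only [Alg1.upR, Function.update_self]
      refine ⟨R.lo, R.hi, R.it3, ?_, ?_⟩
      · intro y hy
        rcases memS y _ hy with h | h
        · exact R.bnd y h
        · exact h.1.le
      · simp only [RPcInv]
        exact ⟨p1, p2, p3.frame I.sh.wlow pre le_rfl, p4, p6, by simp [sl]⟩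
    · simp only [Alg1.upR, Function.update_of_ne e]
      refine (I.rd i').frame I.sh.wlow pre le_rfl ?_
      intro y hy
      rcases memS y _ hy with h | h
      · exact h
      · exact absurd (Entry.r.inj h.2) e
  · intro j
    refine (I.wr j).frame I.sh.wlow pre le_rfl ?_
    intro y v h hy
    rcases memS y _ hy with h | h
    · exact h
    · cases h.2
  · intro i'
    by_cases e : i' = i
    · subst e
      simp only [Alg1.upR, Function.update_self]
      exact (I.ph i').frame I.sh.wlow pre R.hi (by simp [h, inLoop]) (fun _ => rfl) rfl
        (.inl rfl) hw
    · simp only [Alg1.upR, Function.update_of_ne e]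
      exact (I.ph i').frame I.sh.wlow pre (I.rd i').hi id (fun _ => rfl) rfl
        (.inl rfl) hw

/-- A writer posts its `w`-tuple. -/
theorem Inv.ww {c : Config m n} (I : Inv c) (j : Fin n) (h : (c.wst j).pc = .post) :
    Inv { Alg1.upW c j { c.wst j with pc := .postR } with
      slr := Function.update c.slr (c.wst j).mc.widx
        (slide (m + n) (c.slr (c.wst j).mc.widx) (.w j (c.wst j).v (c.wst j).toHelp)) } := by
  have P := I.wr j
  simp only [WInv, h] at P
  obtain ⟨p1, p2, p3⟩ := P
  generalize hx : (c.wst j).mc.widx = x at *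
  generalize he : (Entry.w j (c.wst j).v (c.wst j).toHelp : Entry m n) = e at *
  have ho : own e ∉ (c.slr x).map own := by
    intro hm
    obtain ⟨e', he', heq⟩ := List.mem_map.1 hm
    subst he
    cases e' with
    | r => simp [own] at heq
    | w j' v' h' => simp [own] at heq; subst heq; exact absurd (p3 _ _ _ he') (lt_irrefl _)
  obtain ⟨sl, pre, sh⟩ := I.sh.app (by have := p1.le; omega) ho
  have memS : ∀ y e', e' ∈ Function.update c.slr x (slide (m + n) (c.slr x) e) y →
      e' ∈ c.slr y ∨ (y = x ∧ e' = e) := by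
    intro y e' he
    by_cases h : y = x
    · subst h; simpa [sl] using he
    · simp [h] at he; exact .inl he
  refine ⟨sh, ?_, ?_, ?_⟩
  · intro i
    refine (I.rd i).frame I.sh.wlow pre le_rfl ?_
    intro y hy
    rcases memS y _ hy with h | h
    · exact h
    · rw [← he] at h; cases h.2
  · intro j'
    by_cases e' : j' = j
    · subst e'
      simp only [Alg1.upW, Function.update_self, WInv]
      rw [hx]
      refine ⟨p1.frame I.sh.wlow pre le_rfl, ?_, ?_⟩
      · rw [Function.update_self, sl, hasW_append, ← he]
        simp [hasW, Entry.isW]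
      · intro y v h hy
        rcases memS y _ hy with h | h
        · exact (p3 _ _ _ h).le
        · exact h.1.le
    · simp only [Alg1.upW, Function.update_of_ne e']
      refine (I.wr j').frame I.sh.wlow pre le_rfl ?_
      intro y v h hy
      rcases memS y _ hy with h | h
      · exact h
      · have h2 := h.2
        rw [← he] at h2
        cases h2
        exact absurd rfl e'
  · intro i h1 h2
    obtain ⟨l1, a1, a2, a3, a4, a5⟩ := I.ph i h1 h2
    have hi := (I.rd i).hi
    refine ⟨l1, a1, a2, a3, ?_, ?_⟩
    · intro y b1 b2
      change y < (c.rst i).lsr at b2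
      rw [show readersOf _ = _ from readersOf_eq (pre y) (I.sh.wlow y (by omega) (by omega))]
      exact a4 y b1 b2
    · intro w b1 b2 b3
      obtain ⟨c1, c2⟩ := a5 w b1 b2
        (fun x d1 d2 d3 => b3 x d1 d2 (readersOf_mono (pre x) d3))
      refine ⟨?_, ?_⟩
      · intro hw
        by_cases e' : w = x
        · subst e'
          by_cases hw0 : hasW (c.slr w) = true
          · exact readersOf_mono (pre w) (c1 hw0)
          · rcases ((c2 j hx) (.inr (.inr h))).1 (by rw [p2]; exact i.2) with hh | hh
            · have hq := readersOf_w (l := c.slr w) (by simpa using hw0) j (c.wst j).v _ hh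
              rw [he] at hq
              change i ∈ readersOf (Function.update c.slr w (slide (m + n) (c.slr w) e) w)
              rw [Function.update_self, sl]
              exact hq
            · rw [hx] at hh
              exact readersOf_mono (pre w) hh
        · simp only [Function.update_of_ne e'] at hw ⊢
          exact c1 hw
      · intro j' hj
        by_cases e' : j' = j
        · subst e'
          simp [Alg1.upW, WC]
        · simp only [Alg1.upW, Function.update_of_ne e'] at hj ⊢
          exact (c2 j' hj).frame pre

/-- A new iteration of the repeat loop starts. -/
theorem Inv.loop {c : Config m n} (I : Inv c) (i : Fin m) (h : (c.rst i).pc = .loopM) :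
    Inv (Alg1.upR c i (if (c.rst i).lsr < c.M.ridx i then
                { c.rst i with mc := c.M, it := (c.rst i).it + 1, lsr := c.M.ridx i, pc := .helpVal }
              else
                { c.rst i with mc := c.M, it := (c.rst i).it + 1, lsr := c.M.widx, pc := .annH })) := by
  have R := I.rd i
  have P := R.pci
  have G := I.sh.good
  have lo := G.lo i
  have hi := G.hi i
  simp only [RPcInv, h] at P
  obtain ⟨p1, p2, p3⟩ := P
  split_ifs with hl
  · refine I.upR i _ ⟨lo, hi.le, by simp; omega, ?_, ?_⟩ ?_
    · intro x hx
      exact (R.bnd x hx).trans hl.le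
    · simpa [RPcInv] using hi
    · intro h1; simp [inLoop] at h1
  · refine I.upR i _ ⟨by have := G.pos; simp; omega, le_rfl, by simp; omega, ?_, ?_⟩ ?_
    · intro x hx
      exact (R.bnd x hx).trans p1.le
    · simp only [RPcInv]
      refine ⟨G.pos, by omega, G, trivial, ?_⟩
      intro hm
      have := R.bnd _ hm
      omega
    · intro h1 h2
      simp only at h2 ⊢
      obtain ⟨q1, q2, q3⟩ := p3 (by omega)
      have key : ∃ l1, 0 ≤ l1 ∧ l1 ≤ c.H i ∧
          (∀ x, l1 ≤ x → x < (c.rst i).lsr → i ∉ readersOf (c.slr x)) := by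
        by_cases e : (c.rst i).it = 1
        · exact ⟨(c.rst i).lsr, q1, q2.ge, fun x _ _ => by omega⟩
        · obtain ⟨l1, a1, a2, a3, a4, a5⟩ := I.ph i (by simp [h, inLoop]) (by omega)
          exact ⟨l1, a1, a2, a4⟩
      have key2 : ∀ w, c.M.widx < w → hasW (c.slr w) = true → False := by
        intro w hw hh
        simp [I.sh.empt w hw, hasW] at hh
      have ext : ∀ l1, (∀ x, l1 ≤ x → x < (c.rst i).lsr → i ∉ readersOf (c.slr x)) →
          ∀ x, l1 ≤ x → x < c.M.widx → i ∉ readersOf (c.slr x) := by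
        intro l1 hl1 x hx1 hx2
        rcases lt_trichotomy x (c.rst i).lsr with h | h | h
        · exact hl1 x hx1 h
        · rwa [h]
        · exact G.non i x (by omega) hx2
      by_cases e : (c.rst i).it = 1
      · obtain ⟨l1, a1, a2, a3⟩ := key
        refine ⟨l1, a1, a2, by omega, ext l1 a3, ?_⟩
        intro w b1 b2 b3
        have hlt := b2 (by omega)
        refine ⟨fun hh => (key2 w hlt hh).elim, ?_⟩
        intro j hj hpc
        exfalso
        have hw := I.wr j
        have : Good c.slr c.M.widx (c.wst j).mc := by
          rcases hpc with hp | hp | hp <;> simp only [WInv, hp] at hw <;> exact hw.1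
        have := this.le
        omega
      · obtain ⟨l1, a1, a2, a3, a4, a5⟩ := I.ph i (by simp [h, inLoop]) (by omega)
        refine ⟨l1, a1, a2, by omega, ext l1 a4, ?_⟩
        intro w b1 b2 b3
        exact a5 w (by omega) (fun _ => by omega) b3

/-- End of an iteration. -/
theorem Inv.loopEnd {c : Config m n} (I : Inv c) (i : Fin m) (h : (c.rst i).pc = .loopEnd) :
    Inv (Alg1.upR c i { c.rst i with
      pc := if i ∈ readersOf (c.rst i).win then RPC.retNow else RPC.loopM }) := by
  have R := I.rd i
  have P := R.pci
  simp only [RPcInv, h] at P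
  obtain ⟨p1, p2, p3, p4, p5, p6⟩ := P
  split_ifs with hm
  · exact I.upR' i _ ⟨R.lo, R.hi, R.it3, R.bnd, trivial⟩ (by simp [inLoop]) (by simp) (by simp)
  · have hw : hasW (c.rst i).win = true := by
      by_contra hc
      exact hm (mem_readersOf p4 (by simpa using hc))
    have hR := readersOf_eq p5 hw
    refine I.upR' i _ ⟨R.lo, R.hi, R.it3, R.bnd, ?_⟩ (by simp [inLoop, h]) (by simp) (by simp)
    simp only [RPcInv]
    refine ⟨p6 hw, ?_, fun _ => ⟨p1, p3, by rwa [hR]⟩⟩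
    by_contra hc
    have := R.it3
    obtain ⟨l1, a1, a2, a3, a4, a5⟩ := I.ph i (by simp [h, inLoop]) (by omega)
    have := (a5 _ le_rfl (by omega) a4).1 (hasW_pre p5 hw)
    rw [hR] at this
    exact hm this

theorem inv_step {c c' : Config m n} {l : Lbl m n} (I : Inv c) (h : Step c l c') : Inv c' := by
  cases l with
  | invRead i =>
    obtain ⟨h1, rfl⟩ := h
    have R := I.rd i
    have G := I.sh.good.pos
    refine I.upR i _ ⟨R.lo, R.hi, by simp, R.bnd, ?_⟩ ?_
    · have := R.lo
      split_ifs with hh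
      · simpa [RPcInv] using hh
      · simp [RPcInv]; omega
    · intro h1 h2; simp at h2
  | respRead i v =>
    obtain ⟨h1, h2, rfl⟩ := h
    have R := I.rd i
    exact I.upR' i _ ⟨R.lo, R.hi, R.it3, R.bnd, trivial⟩ (by simp [inLoop]) (by simp) (by simp)
  | invWrite j v =>
    obtain ⟨h1, rfl⟩ := h
    have P := I.wr j
    simp only [WInv, h1] at P
    exact I.upW j _ P (by intros; simp [WC])
  | respWrite j =>
    obtain ⟨h1, rfl⟩ := h
    have P := I.wr j
    simp only [WInv, h1] at P
    exact I.upW j _ P (by intros; simp [WC])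
  | invAudit a =>
    obtain ⟨h1, rfl⟩ := h
    exact I.upA a _
  | respAudit a A =>
    obtain ⟨h1, h2, rfl⟩ := h
    exact I.upA a _
  | slrRead p x win =>
    cases p with
    | rdr i =>
      have R := I.rd i
      have P := R.pci
      obtain ⟨rfl, h⟩ := h
      rcases h with ⟨h1, rfl, rfl⟩ | ⟨h1, rfl, rfl⟩ | ⟨h1, rfl, rfl⟩ | ⟨h1, rfl, rfl⟩
      · simp only [RPcInv, h1] at P
        refine I.upR' i _ ⟨R.lo, R.hi, R.it3, R.bnd, ?_⟩ ?_ (by simp) (by simp)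
        · split_ifs with hh
          · exact ⟨P.1, P.2, hh, List.prefix_rfl⟩
          · trivial
        · split_ifs <;> simp [inLoop]
      · exact I.upR' i _ ⟨R.lo, R.hi, R.it3, R.bnd, trivial⟩ (by simp [inLoop]) (by simp) (by simp)
      · simp only [RPcInv, h1] at P
        obtain ⟨p1, p2, p3, p4, p5, p6⟩ := P
        exact I.upR' i _ ⟨R.lo, R.hi, R.it3, R.bnd, ⟨p1, p2, p3, p4, p5, p6, List.prefix_rfl⟩⟩
          (by simp [inLoop, h1]) (by simp) (by simp)
      · simp only [RPcInv, h1] at P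
        exact I.upR' i _ ⟨R.lo, R.hi, R.it3, R.bnd, P⟩
          (by simp [inLoop, h1]) (by simp) (by simp)
    | wtr j =>
      have P := I.wr j
      obtain ⟨rfl, h⟩ := h
      rcases h with ⟨h1, rfl, hk, rfl⟩ | ⟨h1, rfl, rfl⟩ | ⟨h1, rfl, rfl⟩
      · simp only [WInv, h1] at P
        refine I.upW j _ P ?_
        intro i l1 b1 b2 b3 b4 b5 _
        have b6 := b5 rfl (.inr (.inl h1))
        refine ⟨fun hik => ?_, by simp⟩
        simp only at hik b4 ⊢
        by_cases e : (i : ℕ) = (c.wst j).k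
        · have ei : (⟨(c.wst j).k, hk⟩ : Fin m) = i := Fin.ext e.symm
          rw [ei]
          obtain ⟨d1, d2⟩ := b6.2 h1 e.symm
          split_ifs with hm
          · right
            by_cases e2 : (c.wst j).a = (c.wst j).mc.widx
            · rwa [← e2]
            · exact absurd hm (b4 _ d1 (by omega))
          · left; simp
        · rcases b6.1 (by omega) with hh | hh
          · left; split_ifs
            · exact hh
            · exact Finset.mem_insert_of_mem hh
          · exact .inr hh
      · simp only [WInv, h1] at P
        exact I.upW j _ ⟨P.1, P.2.1, List.prefix_rfl, P.2.2⟩ (by intros; simp [WC])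
      · simp only [WInv, h1] at P
        exact I.upW j _ P (by intros; simp [WC])
    | adt a =>
      obtain ⟨rfl, h⟩ := h
      rcases h with ⟨h1, rfl, rfl⟩ | ⟨h1, rfl, rfl⟩ <;> exact I.upA a _
  | slrWrite p x e =>
    cases p with
    | rdr i =>
      obtain ⟨h1, rfl, rfl, rfl⟩ := h
      exact I.rw i h1
    | wtr j =>
      obtain ⟨h1, rfl, rfl, rfl⟩ := h
      exact I.ww j h1
    | adt a => exact h.elim
  | mRead p v =>
    cases p with
    | rdr i =>
      have R := I.rd i
      have P := R.pci
      obtain ⟨rfl, h⟩ := h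
      rcases h with ⟨h1, rfl⟩ | ⟨h1, rfl⟩
      · simp only [RPcInv, h1] at P
        obtain ⟨p1, p2, p3, p4⟩ := P
        refine I.upR' i _ ⟨R.lo, R.hi, R.it3, R.bnd, ?_⟩ (by simp [p2]) (by simp) (by simp)
        split_ifs with hh
        · exact ⟨p1, p2, p3, p4, I.sh.good, hh⟩
        · have := R.hi
          simp [RPcInv, p2]; omega
      · exact I.loop i h1
    | wtr j =>
      have P := I.wr j
      obtain ⟨rfl, h1, rfl⟩ := h
      simp only [WInv, h1] at P
      exact I.upW j _ ⟨I.sh.good, P⟩ (by intros; simp [WC])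
    | adt a =>
      obtain ⟨rfl, h1, rfl⟩ := h
      exact I.upA a _
  | mWrite p v =>
    cases p with
    | rdr i =>
      have P := (I.rd i).pci
      rcases h with ⟨h1, rfl, rfl⟩ | ⟨h1, h2, rfl, rfl⟩
      · simp only [RPcInv, h1] at P
        obtain ⟨p1, p2, p3, p4, p5, p6⟩ := P
        obtain ⟨J, j1, j2⟩ := I.mw (c.rst i).lval p5 p6 p3 p4
        have R := J.rd i
        exact J.upR' i { c.rst i with pc := .loopM }
          ⟨R.lo, R.hi, R.it3, R.bnd, ⟨j2, by simp [p2], by simp [p2]⟩⟩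
          (by simp [p2]) (by simp) (by simp)
      · simp only [RPcInv, h1] at P
        obtain ⟨p1, p2, p3, p4, p5, p6, p7⟩ := P
        obtain ⟨J, j1, j2⟩ := I.mw (c.rst i).lval p3 p4 h2 p7
        have R := J.rd i
        exact J.upR' i { c.rst i with pc := .loopEnd }
          ⟨R.lo, R.hi, R.it3, R.bnd, ⟨p1, p2, p5, p6, p7, fun _ => j2⟩⟩
          (by simp [h1, inLoop]) (by simp) (by simp)
    | wtr j =>
      have P := I.wr j
      obtain ⟨h1, rfl, rfl⟩ := h
      simp only [WInv, h1] at P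
      obtain ⟨p1, p2, p3, p4⟩ := P
      obtain ⟨J, j1, j2⟩ := I.mw (c.wst j).val p1 rfl p2 p3
      refine J.upW j { c.wst j with pc := .wret } ?_ (by intros; simp [WC])
      intro x v h hx
      exact (p4 x v h hx).trans_lt j2
    | adt a => exact h.elim
  | hRead j k a =>
    have P := I.wr j
    obtain ⟨h1, hk, rfl, rfl⟩ := h
    simp only [WInv, h1] at P
    refine I.upW j _ ?_ ?_
    · split_ifs
      · simpa only [WInv] using P
      · simpa only [WInv, h1] using P
    · intro i l1
      split_ifs with hlt <;> intro b1 b2 b3 b4 b5 _ <;> simp only at b3 b4 b5 ⊢ <;>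
        have b6 := b5 trivial (.inl h1)
      · refine ⟨b6.1, fun _ e => ?_⟩
        have : k = i := Fin.ext (hk.trans e)
        subst this
        exact ⟨b2, b3⟩
      · refine ⟨fun hik => ?_, by simp [h1]⟩
        by_cases e : (i : ℕ) = (c.wst j).k
        · have : k = i := Fin.ext (hk.trans e.symm)
          subst this
          exfalso
          have g := P.1
          exact b4 _ (by omega) (g.hi k) (g.mem k (by omega))
        · exact b6.1 (by omega)
  | hWrite i x =>
    have P := (I.rd i).pci
    obtain ⟨h1, rfl, rfl⟩ := h
    simp only [RPcInv, h1] at P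
    obtain ⟨p1, p2, p3, p4, p5⟩ := P
    have J := I.hw i h1
    have R := J.rd i
    exact J.upR' i { c.rst i with pc := .wSLR }
      ⟨R.lo, R.hi, R.it3, R.bnd, ⟨p1, p2, p3, p4, p5, by simp⟩⟩
      (by simp [h1, inLoop]) (by simp) (by simp)
  | tau p =>
    cases p with
    | rdr i =>
      rcases h with ⟨h1, h2, rfl⟩ | ⟨h1, rfl⟩
      · have R := I.rd i
        have P := R.pci
        simp only [RPcInv, h1] at P
        obtain ⟨p1, p2, p3, p4, p5, p6, p7⟩ := P
        exact I.upR' i _ ⟨R.lo, R.hi, R.it3, R.bnd, ⟨p1, p2, p5, p6, p7, by simp [h2]⟩⟩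
          (by simp [h1, inLoop]) (by simp) (by simp)
      · exact I.loopEnd i h1
    | wtr j =>
      have P := I.wr j
      obtain ⟨h1, h2, rfl⟩ := h
      simp only [WInv, h1] at P
      refine I.upW j _ ⟨P.1, h2, P.2⟩ ?_
      intro i l1 b1 b2 b3 b4 b5 _
      exact ⟨(b5 rfl (.inl h1)).1, by simp⟩
    | adt a => exact h.elim

theorem inv_exec (E : Exec m n v0 j0) : ∀ t, t ≤ E.len → Inv (E.cfg t) := by
  intro t
  induction t with
  | zero => intro _; rw [E.h0]; exact inv_init v0 j0
  | succ t ih => intro ht; exact inv_step (ih (by omega)) (E.hstep t (by omega))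

/-! ### Counting steps -/

/-- Bound on the number of remaining steps of a READ. -/
def pot (s : RState m n) : ℕ :=
  match s.pc with
  | .idle => 0
  | .retNow => 1
  | .helpVal => 2
  | .loopM => 7 * (3 - s.it) + 2
  | .loopEnd => 7 * (3 - s.it) + 3
  | .helpChk => 7 * (3 - s.it) + 4
  | .gVal => 7 * (3 - s.it) + 5
  | .rSLR => 7 * (3 - s.it) + 6
  | .wSLR => 7 * (3 - s.it) + 7
  | .annH => 7 * (3 - s.it) + 8
  | .preHelp => 7 * (3 - s.it) + 3
  | .preM => 7 * (3 - s.it) + 4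
  | .precheck => 7 * (3 - s.it) + 5

theorem step_other {c c' : Config m n} {l : Lbl m n} (h : Step c l c') (i : Fin m)
    (hp : procOf l ≠ .rdr i) : c'.rst i = c.rst i := by
  have key : ∀ i' s, Proc.rdr i' ≠ (Proc.rdr i : Proc m n) →
      Function.update c.rst i' s i = c.rst i := by
    intro i' s hne
    exact Function.update_of_ne (fun e => hne (by rw [e])) _ _
  cases l with
  | invRead i' => obtain ⟨h1, rfl⟩ := h; exact key _ _ hp
  | respRead i' v => obtain ⟨h1, h2, rfl⟩ := h; exact key _ _ hp
  | invWrite j v => obtain ⟨h1, rfl⟩ := h; rfl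
  | respWrite j => obtain ⟨h1, rfl⟩ := h; rfl
  | invAudit a => obtain ⟨h1, rfl⟩ := h; rfl
  | respAudit a A => obtain ⟨h1, h2, rfl⟩ := h; rfl
  | slrRead p x win =>
    cases p with
    | rdr i' =>
      obtain ⟨rfl, h⟩ := h
      rcases h with ⟨h1, h2, rfl⟩ | ⟨h1, h2, rfl⟩ | ⟨h1, h2, rfl⟩ | ⟨h1, h2, rfl⟩ <;>
        exact key _ _ hp
    | wtr j =>
      obtain ⟨rfl, h⟩ := h
      rcases h with ⟨h1, h2, hk, rfl⟩ | ⟨h1, h2, rfl⟩ | ⟨h1, h2, rfl⟩ <;> rfl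
    | adt a =>
      obtain ⟨rfl, h⟩ := h
      rcases h with ⟨h1, h2, rfl⟩ | ⟨h1, h2, rfl⟩ <;> rfl
  | slrWrite p x e =>
    cases p with
    | rdr i' => obtain ⟨h1, h2, h3, rfl⟩ := h; exact key _ _ hp
    | wtr j => obtain ⟨h1, h2, h3, rfl⟩ := h; rfl
    | adt a => exact h.elim
  | mRead p v =>
    cases p with
    | rdr i' =>
      obtain ⟨rfl, h⟩ := h
      rcases h with ⟨h1, rfl⟩ | ⟨h1, rfl⟩ <;> exact key _ _ hp
    | wtr j => obtain ⟨rfl, h1, rfl⟩ := h; rfl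
    | adt a => obtain ⟨rfl, h1, rfl⟩ := h; rfl
  | mWrite p v =>
    cases p with
    | rdr i' =>
      rcases h with ⟨h1, h2, rfl⟩ | ⟨h1, h2, h3, rfl⟩ <;> exact key _ _ hp
    | wtr j => obtain ⟨h1, h2, rfl⟩ := h; rfl
    | adt a => exact h.elim
  | hRead j k a => obtain ⟨h1, hk, h2, rfl⟩ := h; rfl
  | hWrite i' x => obtain ⟨h1, h2, rfl⟩ := h; exact key _ _ hp
  | tau p =>
    cases p with
    | rdr i' =>
      rcases h with ⟨h1, h2, rfl⟩ | ⟨h1, rfl⟩ <;> exact key _ _ hp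
    | wtr j => obtain ⟨h1, h2, rfl⟩ := h; rfl
    | adt a => exact h.elim

theorem step_own {c c' : Config m n} {l : Lbl m n} (I : Inv c) (h : Step c l c') (i : Fin m)
    (hp : procOf l = .rdr i) (hi : (c.rst i).pc ≠ .idle) (hl : ∀ v, l ≠ .respRead i v) :
    (c'.rst i).pc ≠ .idle ∧ pot (c'.rst i) + 1 ≤ pot (c.rst i) := by
  have P := (I.rd i).pci
  cases l with
  | invRead i' =>
    cases hp
    exact absurd h.1 hi
  | respRead i' v => cases hp; exact absurd rfl (hl v)
  | invWrite j v => cases hp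
  | respWrite j => cases hp
  | invAudit a => cases hp
  | respAudit a A => cases hp
  | slrRead p x win =>
    cases hp
    obtain ⟨rfl, h⟩ := h
    rcases h with ⟨h1, h2, rfl⟩ | ⟨h1, h2, rfl⟩ | ⟨h1, h2, rfl⟩ | ⟨h1, h2, rfl⟩
    · simp only [upR, Function.update_self]
      split_ifs <;> simp [pot, h1]
    all_goals simp [upR, pot, h1]
  | slrWrite p x e =>
    cases hp
    obtain ⟨h1, h2, h3, rfl⟩ := h
    simp [upR, pot, h1]
  | mRead p v =>
    cases hp
    obtain ⟨rfl, h⟩ := h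
    rcases h with ⟨h1, rfl⟩ | ⟨h1, rfl⟩
    · simp only [upR, Function.update_self]
      split_ifs <;> simp [pot, h1]
    · simp only [RPcInv, h1] at P
      simp only [upR, Function.update_self]
      split_ifs <;> simp [pot, h1] <;> omega
  | mWrite p v =>
    cases hp
    rcases h with ⟨h1, h2, rfl⟩ | ⟨h1, h2, h3, rfl⟩ <;> simp [upR, pot, h1]
  | hRead j k a => cases hp
  | hWrite i' x =>
    cases hp
    obtain ⟨h1, h2, rfl⟩ := h
    simp [upR, pot, h1]
  | tau p =>
    cases hp
    rcases h with ⟨h1, h2, rfl⟩ | ⟨h1, rfl⟩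
    · simp [upR, pot, h1]
    · simp only [upR, Function.update_self]
      split_ifs <;> simp [pot, h1]

theorem count_steps (E : Exec m n v0 j0) (i : Fin m) (tinv tresp : ℕ)
    (hr : tresp < E.len) (hinv : E.lbl tinv = .invRead i)
    (hno : ∀ t, tinv < t → t < tresp → ∀ v', E.lbl t ≠ .respRead i v') :
    ∀ d, tinv + d + 1 ≤ tresp →
      ((E.cfg (tinv + d + 1)).rst i).pc ≠ .idle ∧
      ((Finset.Icc tinv (tinv + d)).filter
        (fun t => procOf (E.lbl t) = Proc.rdr i)).card +
        pot ((E.cfg (tinv + d + 1)).rst i) ≤ 27 := by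
  intro d
  induction d with
  | zero =>
    intro hd
    have hs := E.hstep tinv (by omega)
    rw [hinv] at hs
    obtain ⟨h1, h2⟩ := hs
    have hc : ((Finset.Icc tinv (tinv + 0)).filter
        (fun t => procOf (E.lbl t) = Proc.rdr i)).card ≤ 1 :=
      (Finset.card_filter_le _ _).trans (by simp)
    have : ((E.cfg (tinv + 0 + 1)).rst i).pc ≠ .idle ∧
        pot ((E.cfg (tinv + 0 + 1)).rst i) ≤ 26 := by
      rw [Nat.add_zero, h2]
      simp only [upR, Function.update_self]
      split_ifs <;> simp [pot]
    exact ⟨this.1, by omega⟩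
  | succ d ih =>
    intro hd
    obtain ⟨i1, i2⟩ := ih (by omega)
    have hs := E.hstep (tinv + d + 1) (by omega)
    have I := inv_exec E (tinv + d + 1) (by omega)
    have hIcc : Finset.Icc tinv (tinv + (d + 1)) =
        insert (tinv + d + 1) (Finset.Icc tinv (tinv + d)) := by
      ext t; simp only [Finset.mem_Icc, Finset.mem_insert]; omega
    rw [hIcc, Finset.filter_insert, show tinv + (d + 1) + 1 = tinv + d + 1 + 1 by omega]
    by_cases hp : procOf (E.lbl (tinv + d + 1)) = Proc.rdr i
    · rw [if_pos hp]
      obtain ⟨o1, o2⟩ := step_own I hs i hp i1 (hno _ (by omega) (by omega))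
      refine ⟨o1, ?_⟩
      have := Finset.card_insert_le (tinv + d + 1)
        ((Finset.Icc tinv (tinv + d)).filter (fun t => procOf (E.lbl t) = Proc.rdr i))
      omega
    · rw [if_neg hp, step_other hs i hp]
      exact ⟨i1, i2⟩

/-- Lemma `wait_free`.  In any execution of Algorithm 1,
every READ operation terminates within at most three iterations of its repeat
loop (the per-operation iteration counter never exceeds `3`), and
consequently the step complexity of a READ operation is `O(m+n)`: there is a
constant `C` such that, in every execution, a reader takes at most
`C * (m + n)` steps of its own between the invocation and the response of any
of its READ operations. -/
theorem read_three_iterations :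
    ∃ C : ℕ, ∀ (m n : ℕ) (v0 : Val) (j0 : Fin n) (E : Exec m n v0 j0),
      (∀ t, t ≤ E.len → ∀ i : Fin m, ((E.cfg t).rst i).it ≤ 3) ∧
      (∀ (i : Fin m) (tinv tresp : ℕ) (v : Val),
        tinv < tresp → tresp < E.len →
        E.lbl tinv = .invRead i → E.lbl tresp = .respRead i v →
        (∀ t, tinv < t → t < tresp → ∀ v', E.lbl t ≠ .respRead i v') →
        ((Finset.Icc tinv tresp).filter
            (fun t => procOf (E.lbl t) = Proc.rdr i)).card ≤ C * (m + n)) := by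
  refine ⟨28, fun m n v0 j0 E => ⟨fun t ht i => ((inv_exec E t ht).rd i).it3, ?_⟩⟩
  intro i tinv tresp v hlt hr hinv _ hno
  obtain ⟨d, rfl⟩ : ∃ d, tresp = tinv + d + 1 := ⟨tresp - tinv - 1, by omega⟩
  have h := (count_steps E i tinv _ hr hinv hno d le_rfl).2
  have hIcc : Finset.Icc tinv (tinv + d + 1) =
      insert (tinv + d + 1) (Finset.Icc tinv (tinv + d)) := by
    ext t; simp only [Finset.mem_Icc, Finset.mem_insert]; omega
  have hc : ((Finset.Icc tinv (tinv + d + 1)).filter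
      (fun t => procOf (E.lbl t) = Proc.rdr i)).card ≤ 28 := by
    rw [hIcc, Finset.filter_insert]
    have := Finset.card_insert_le (tinv + d + 1)
      ((Finset.Icc tinv (tinv + d)).filter (fun t => procOf (E.lbl t) = Proc.rdr i))
    split_ifs <;> omega
  have hm := i.pos
  calc _ ≤ 28 := hc
    _ ≤ 28 * (m + n) := by omega

end Alg1
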